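/- Let p be a prime, k ≥ 3, and let G = γ₁ × γ₂ × ⋯ × γ_k be a torus with |G| = p^r for some positive integer r (equivalently, the number of vertices of every cycle γ_i is a power of p). Then mrl(G) ≥ ⌊k/3⌋ + 1. -/

import Mathlib

/-!
A torus is the Cartesian (box) product of cycle graphs `γ₁ × ⋯ × γ_k` where
`γ_i` is a cycle on `sz i ≥ 3` vertices.  We model its vertex set as
`∀ i, ZMod (sz i)`, with two vertices adjacent when they differ in exactly one
coordinate, by `±1` around that cycle.  A Hamiltonian cycle is a cyclic
enumeration `f : ZMod N → V` (with `N` the number of vertices) which is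
bijective and takes consecutive vertices to adjacent vertices.  The run length
of a Hamiltonian cycle is the largest `r ≥ 1` such that any `r` consecutive
edges contain at most one edge in any single dimension, and `mrl` is the
maximum run length over all Hamiltonian cycles.
-/

/-- Vertices of the torus with dimension sizes `sz`. -/
def TorusVtx (k : ℕ) (sz : Fin k → ℕ) : Type := ∀ i : Fin k, ZMod (sz i)

/-- The number of vertices of the torus with dimension sizes `sz`. -/
def torusCard (k : ℕ) (sz : Fin k → ℕ) : ℕ := ∏ i : Fin k, sz i

/-- Adjacency in the torus: the two vertices differ in exactly one coordinate,
and there by one step around the corresponding cycle. -/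
def TorusAdj {k : ℕ} {sz : Fin k → ℕ} (u v : TorusVtx k sz) : Prop :=
  ∃ i : Fin k, (v i = u i + 1 ∨ u i = v i + 1) ∧ ∀ j : Fin k, j ≠ i → u j = v j

/-- A Hamiltonian cycle of the torus, as a cyclic enumeration of all of its
vertices in which consecutive vertices are adjacent. -/
def IsHamCycle {k : ℕ} {sz : Fin k → ℕ}
    (f : ZMod (torusCard k sz) → TorusVtx k sz) : Prop :=
  Function.Bijective f ∧ ∀ t, TorusAdj (f t) (f (t + 1))

/-- The edge of the cycle `f` at position `s` (joining `f s` to `f (s+1)`)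
is in dimension `i`, i.e. its endpoints differ in coordinate `i`. -/
def EdgeInDim {k : ℕ} {sz : Fin k → ℕ}
    (f : ZMod (torusCard k sz) → TorusVtx k sz) (i : Fin k)
    (s : ZMod (torusCard k sz)) : Prop :=
  f s i ≠ f (s + 1) i

/-- Any `r` consecutive edges of the cycle `f` (read cyclically) contain at
most one edge in any single dimension. -/
def WindowOk {k : ℕ} {sz : Fin k → ℕ}
    (f : ZMod (torusCard k sz) → TorusVtx k sz) (r : ℕ) : Prop :=
  ∀ (t : ZMod (torusCard k sz)) (i : Fin k) (a b : ℕ), a < r → b < r → a ≠ b →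
    ¬(EdgeInDim f i (t + (a : ZMod (torusCard k sz))) ∧
      EdgeInDim f i (t + (b : ZMod (torusCard k sz))))

/-- The run length of a Hamiltonian cycle: the largest `r ≥ 1` such that any
`r` consecutive edges contain at most one edge in any single dimension. -/
noncomputable def runLength {k : ℕ} {sz : Fin k → ℕ}
    (f : ZMod (torusCard k sz) → TorusVtx k sz) : ℕ :=
  sSup {r : ℕ | 1 ≤ r ∧ WindowOk f r}

/-- The maximum run length of the torus: the maximum of `runLength` over all
of its Hamiltonian cycles. -/
noncomputable def mrl (k : ℕ) (sz : Fin k → ℕ) : ℕ :=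
  sSup {m : ℕ | ∃ f, IsHamCycle (k := k) (sz := sz) f ∧ m = runLength f}

/-- A periodic integer walk `c` whose `t`-th step is one unit in dimension `d t`, which visits every
vertex of the torus with dimension sizes `n` exactly once per period, and in which any `R`
consecutive steps are in distinct dimensions. -/
def HasRun {ι : Type*} [Fintype ι] (n : ι → ℕ) (R : ℕ) : Prop :=
  ∃ (c : ℤ → ι → ℤ) (d : ℤ → ι),
    (∀ t, (c (t + 1) (d t) = c t (d t) + 1 ∨ c t (d t) = c (t + 1) (d t) + 1) ∧
      ∀ i, i ≠ d t → c (t + 1) i = c t i) ∧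
    (∀ s t, (∀ i, c s i ≡ c t i [ZMOD n i]) ↔ s ≡ t [ZMOD (∏ i, n i : ℕ)]) ∧
    ∀ s t : ℤ, s < t → t < s + R → d s ≠ d t

theorem HasRun.comp_equiv {ι κ : Type*} [Fintype ι] [Fintype κ] {n : ι → ℕ} {R : ℕ}
    (e : κ ≃ ι) (h : HasRun (n ∘ e) R) : HasRun n R := by
  obtain ⟨c, d, hstep, hinj, hrun⟩ := h
  refine ⟨fun t i => c t (e.symm i), fun t => e (d t), fun t => ⟨by simpa using (hstep t).1,
    fun i hi => (hstep t).2 _ fun h => hi (by simp [← h])⟩, fun s t => ?_,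
    fun s t h1 h2 h => hrun s t h1 h2 (e.injective h)⟩
  rw [← e.prod_comp n]
  refine Iff.trans ?_ (hinj s t)
  exact ⟨fun h i => by simpa using h (e i), fun h i => by simpa using h (e.symm i)⟩

/-- A function on the integers which advances by `a` over each period `P`. -/
theorem apply_add_mul_of_apply_add {x : ℤ → ℤ} {P a : ℤ} (hx : ∀ t, x (t + P) = x t + a)
    (t q : ℤ) : x (t + P * q) = x t + a * q := by
  induction q with
  | zero => simp
  | succ q ih => rw [mul_add, mul_one, ← add_assoc, hx, ih]; ring
  | pred q ih =>
    have := hx (t + P * (-(q : ℤ) - 1))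
    rw [show t + P * (-(q : ℤ) - 1) + P = t + P * -(q : ℤ) by ring, ih] at this
    linarith

/-- If `E` detects equality of times modulo `P` and `x` advances by `u * a` over each period `P`,
with `a` coprime to `v`, then `E` and `x` modulo `u * v` detect equality of times modulo `P * v`. -/
theorem modEq_mul_iff {E : ℤ → ℤ → Prop} {x : ℤ → ℤ} {P u v a : ℤ}
    (hE : ∀ s t, E s t ↔ s ≡ t [ZMOD P]) (hx : ∀ t, x (t + P) = x t + u * a) (hP : P ≠ 0)
    (hu : u ≠ 0) (ha : IsCoprime a v) (s t : ℤ) :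
    (E s t ∧ x s ≡ x t [ZMOD u * v]) ↔ s ≡ t [ZMOD P * v] := by
  rw [hE]
  have key : ∀ q, x (t + P * q) ≡ x t [ZMOD u * v] ↔ t + P * q ≡ t [ZMOD P * v] := by
    intro q
    rw [apply_add_mul_of_apply_add hx, Int.modEq_comm, Int.modEq_iff_dvd, Int.modEq_comm,
      Int.modEq_iff_dvd, add_sub_cancel_left, add_sub_cancel_left, mul_assoc,
      mul_dvd_mul_iff_left hu, mul_dvd_mul_iff_left hP]
    exact ⟨fun h => ha.symm.dvd_of_dvd_mul_left h, fun h => h.mul_left a⟩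
  constructor
  · rintro ⟨h1, h2⟩
    obtain ⟨q, hq⟩ := h1.symm.dvd
    obtain rfl : s = t + P * q := by linarith
    exact (key q).1 h2
  · intro h
    have h1 : s ≡ t [ZMOD P] := h.of_mul_right v
    obtain ⟨q, hq⟩ := h1.symm.dvd
    obtain rfl : s = t + P * q := by linarith
    exact ⟨h1, (key q).2 h⟩

theorem add_one_ediv_of_dvd {q : ℤ} {K : ℕ} (hK : 0 < K) :
    (q + 1) / K = q / K + if (K : ℤ) ∣ q + 1 then 1 else 0 := by
  have hK' : (0 : ℤ) < K := by exact_mod_cast hK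
  split_ifs with h
  · obtain ⟨m, hm⟩ := h
    have h1 : (q + 1) / K = m := by rw [hm, Int.mul_ediv_cancel_left _ hK'.ne']
    have h2 : q / K = m - 1 := by
      rw [Int.ediv_eq_iff_of_pos hK']
      constructor <;> nlinarith
    omega
  · rw [add_zero, Int.ediv_eq_iff_of_pos hK']
    have h1 := Int.mul_ediv_add_emod q K
    have h2 := Int.emod_lt_of_pos q hK'
    have h3 := Int.emod_nonneg q hK'.ne'
    have h4 : q % K + 1 ≠ K := fun h4 => h ⟨q / K + 1, by linarith⟩
    have h5 : q % K + 1 < K := by omega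
    constructor <;> nlinarith

section Block

variable {ι : Type*}

/-- Among the blocks of length `Λ`, those whose index is `-1` modulo `K` are special. -/
def blockKind (Λ K : ℕ) (t : ℤ) : Bool := decide ((K : ℤ) ∣ t / Λ + 1)

/-- The dimension of the step at time `t` when special blocks follow the word `W true` and the
others `W false`. -/
def blockDim (Λ K : ℕ) (W : Bool → ℕ → ι) (t : ℤ) : ι :=
  W (blockKind Λ K t) (t % Λ).toNat

variable {Λ K : ℕ} {W : Bool → ℕ → ι} {σ : ℕ → ℤ}

theorem blockDim_ne_add_one (hΛ : 0 < Λ) (hadj : ∀ e j, j + 1 < Λ → W e j ≠ W e (j + 1))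
    (hwrap : ∀ e e', W e (Λ - 1) ≠ W e' 0) (t : ℤ) :
    blockDim Λ K W t ≠ blockDim Λ K W (t + 1) := by
  have hΛ' : (0 : ℤ) < Λ := by exact_mod_cast hΛ
  have h2 := Int.emod_lt_of_pos t hΛ'
  have h3 := Int.emod_nonneg t hΛ'.ne'
  have h1 := Int.mul_ediv_add_emod t Λ
  have h4 := Int.mul_ediv_add_emod (t + 1) Λ
  have hk : ∀ s, blockKind Λ K s = decide ((K : ℤ) ∣ s / Λ + 1) := fun _ => rfl
  unfold blockDim
  by_cases hd : (Λ : ℤ) ∣ t + 1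
  · have hq : (t + 1) / Λ = t / Λ + 1 := by rw [add_one_ediv_of_dvd hΛ, if_pos hd]
    have hj : (t + 1) % Λ = 0 := Int.emod_eq_zero_of_dvd hd
    have hj' : (t % Λ).toNat = Λ - 1 := by
      have : t % Λ + 1 = Λ := by
        rw [hq, hj] at h4
        linarith
      omega
    rw [hj, hj']
    exact hwrap _ _
  · have hq : (t + 1) / Λ = t / Λ := by rw [add_one_ediv_of_dvd hΛ, if_neg hd, add_zero]
    have h5 := Int.emod_lt_of_pos (t + 1) hΛ'
    rw [hq] at h4
    have hj : ((t + 1) % Λ).toNat = (t % Λ).toNat + 1 := by omega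
    rw [hj, hk, hk, hq]
    exact hadj _ _ (by omega)

variable [DecidableEq ι]

/-- The displacement of the first `j` steps of the word `w` with signs `σ`. -/
def wordSum (w : ℕ → ι) (σ : ℕ → ℤ) (j : ℕ) (i : ι) : ℤ :=
  ∑ u ∈ Finset.range j, if w u = i then σ u else 0

/-- The position at time `t` of the walk with steps `blockDim`. -/
def blockPos (Λ K : ℕ) (W : Bool → ℕ → ι) (σ : ℕ → ℤ) (t : ℤ) (i : ι) : ℤ :=
  t / Λ * wordSum (W false) σ Λ i +
    t / Λ / K * (wordSum (W true) σ Λ i - wordSum (W false) σ Λ i) +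
    wordSum (W (blockKind Λ K t)) σ (t % Λ).toNat i

theorem blockPos_add_one (hΛ : 0 < Λ) (hK : 0 < K) (t : ℤ) (i : ι) :
    blockPos Λ K W σ (t + 1) i =
      blockPos Λ K W σ t i + if blockDim Λ K W t = i then σ (t % Λ).toNat else 0 := by
  have hΛ' : (0 : ℤ) < Λ := by exact_mod_cast hΛ
  have h2 := Int.emod_lt_of_pos t hΛ'
  have h3 := Int.emod_nonneg t hΛ'.ne'
  have h1 := Int.mul_ediv_add_emod t Λ
  unfold blockPos blockDim
  have hsucc : ∀ w : ℕ → ι, wordSum w σ (t % Λ).toNat i +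
      (if w (t % Λ).toNat = i then σ (t % Λ).toNat else 0) =
        wordSum w σ ((t % Λ).toNat + 1) i := fun w => (Finset.sum_range_succ _ _).symm
  rw [add_assoc (t / Λ * wordSum (W false) σ Λ i + _), hsucc]
  have hk : ∀ s, blockKind Λ K s = decide ((K : ℤ) ∣ s / Λ + 1) := fun _ => rfl
  by_cases hd : (Λ : ℤ) ∣ t + 1
  · have hq : (t + 1) / Λ = t / Λ + 1 := by rw [add_one_ediv_of_dvd hΛ, if_pos hd]
    have hj : (t + 1) % Λ = 0 := Int.emod_eq_zero_of_dvd hd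
    have hj' : (t % Λ).toNat + 1 = Λ := by
      have : t % Λ + 1 = Λ := by
        have := Int.mul_ediv_add_emod (t + 1) Λ
        rw [hq, hj] at this
        linarith
      omega
    rw [hj', hj, hq, add_one_ediv_of_dvd hK, hk t]
    by_cases hs : (K : ℤ) ∣ t / Λ + 1 <;> simp [hs, wordSum] <;> ring
  · have hq : (t + 1) / Λ = t / Λ := by rw [add_one_ediv_of_dvd hΛ, if_neg hd, add_zero]
    have hj : ((t + 1) % Λ).toNat = (t % Λ).toNat + 1 := by
      have := Int.mul_ediv_add_emod (t + 1) Λ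
      rw [hq] at this
      omega
    rw [hj, hk, hk, hq]

theorem blockPos_add_mul (hΛ : 0 < Λ) (hK : 0 < K) (t : ℤ) (i : ι) :
    blockPos Λ K W σ (t + (Λ * K : ℕ)) i = blockPos Λ K W σ t i +
      (K * wordSum (W false) σ Λ i + (wordSum (W true) σ Λ i - wordSum (W false) σ Λ i)) := by
  have hΛ' : (Λ : ℤ) ≠ 0 := by exact_mod_cast hΛ.ne'
  have hK' : (K : ℤ) ≠ 0 := by exact_mod_cast hK.ne'
  have h1 : (t + (Λ * K : ℕ)) / Λ = t / Λ + K := by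
    rw [Nat.cast_mul, Int.add_mul_ediv_left _ _ hΛ']
  have h2 : (t + (Λ * K : ℕ)) % Λ = t % Λ := by simp
  have h3 : blockKind Λ K (t + (Λ * K : ℕ)) = blockKind Λ K t := by
    simp only [blockKind, h1, add_right_comm _ (K : ℤ), dvd_add_self_right]
  have h4 : (t / Λ + K) / K = t / Λ / K + 1 := by
    rw [Int.add_ediv_of_dvd_right (dvd_refl _), Int.ediv_self hK']
  unfold blockPos
  rw [h1, h2, h3, h4]
  ring

theorem HasRun.of_block [Fintype ι] {n : ι → ℕ} (hΛ : 0 < Λ) (hK : 0 < K)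
    (hadj : ∀ e j, j + 1 < Λ → W e j ≠ W e (j + 1)) (hwrap : ∀ e e', W e (Λ - 1) ≠ W e' 0)
    (hσ : ∀ j, σ j = 1 ∨ σ j = -1)
    (hinj : ∀ s t, (∀ i, blockPos Λ K W σ s i ≡ blockPos Λ K W σ t i [ZMOD n i]) ↔
      s ≡ t [ZMOD (∏ i, n i : ℕ)]) : HasRun n 2 := by
  refine ⟨blockPos Λ K W σ, blockDim Λ K W, fun t => ⟨?_, fun i hi => ?_⟩, hinj,
    fun s t h1 h2 => ?_⟩
  · rw [blockPos_add_one hΛ hK, if_pos rfl]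
    rcases hσ (t % Λ).toNat with h | h <;> rw [h] <;> simp
  · rw [blockPos_add_one hΛ hK, if_neg hi.symm, add_zero]
  · obtain rfl : t = s + 1 := by omega
    exact blockDim_ne_add_one hΛ hadj hwrap s

end Block

section Block

variable {ι : Type*} [DecidableEq ι] {Λ K : ℕ} {W : Bool → ℕ → ι} {σ : ℕ → ℤ}

theorem wordSum_congr {w w' : ℕ → ι} {j : ℕ} {i : ι} (h : ∀ u < j, w u = i ↔ w' u = i) :
    wordSum w σ j i = wordSum w' σ j i :=
  Finset.sum_congr rfl fun u hu => by simp only [h u (Finset.mem_range.1 hu)]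

theorem sum_wordSum [Fintype ι] (w : ℕ → ι) (j : ℕ) :
    ∑ i, wordSum w σ j i = ∑ u ∈ Finset.range j, σ u := by
  simp only [wordSum]
  rw [Finset.sum_comm]
  simp

/-- In a dimension where both kinds of blocks agree, the walk is that of the word `W false`. -/
theorem blockPos_of_forall_iff (hΛ : 0 < Λ) {i : ι}
    (h : ∀ e, ∀ j < Λ, W e j = i ↔ W false j = i) (t : ℤ) :
    blockPos Λ K W σ t i =
      t / Λ * wordSum (W false) σ Λ i + wordSum (W false) σ (t % Λ).toNat i := by
  have hΛ' : (0 : ℤ) < Λ := by exact_mod_cast hΛ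
  have h2 := Int.emod_lt_of_pos t hΛ'
  have h3 := Int.emod_nonneg t hΛ'.ne'
  unfold blockPos
  rw [wordSum_congr (h true), sub_self, mul_zero, add_zero,
    wordSum_congr fun u hu => h (blockKind Λ K t) u (by omega)]

theorem sum_blockPos [Fintype ι] (t : ℤ) :
    ∑ i, blockPos Λ K W σ t i =
      t / Λ * ∑ u ∈ Finset.range Λ, σ u + ∑ u ∈ Finset.range (t % Λ).toNat, σ u := by
  simp only [blockPos, Finset.sum_add_distrib, ← Finset.mul_sum, Finset.sum_sub_distrib,
    sum_wordSum]
  ring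

/-- If merging the dimensions `1` and `2` turns a walk into a Hamiltonian cycle of a torus with
sizes `n 0` and `n 1`, and the special blocks make one more step in dimension `2` in place of a step
in dimension `1`, then the walk is a Hamiltonian cycle of the torus with sizes `n`. -/
theorem HasRun.of_block_of_merge {n : Fin 3 → ℕ} {W : Bool → ℕ → Fin 3} (hΛ : 0 < Λ) (hK : 0 < K)
    (hadj : ∀ e j, j + 1 < Λ → W e j ≠ W e (j + 1)) (hwrap : ∀ e e', W e (Λ - 1) ≠ W e' 0)
    (hσ : ∀ j, σ j = 1 ∨ σ j = -1) (hdvd : n 1 ∣ n 2) (hcard : n 0 * n 1 = Λ * K)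
    (hspecial : wordSum (W true) σ Λ 2 = wordSum (W false) σ Λ 2 + 1)
    (hcop : IsCoprime (K * wordSum (W false) σ Λ 2 + 1) (n 2 : ℤ))
    (hmerge : ∀ s t, (blockPos Λ K W σ s 0 ≡ blockPos Λ K W σ t 0 [ZMOD n 0] ∧
        blockPos Λ K W σ s 1 + blockPos Λ K W σ s 2 ≡
          blockPos Λ K W σ t 1 + blockPos Λ K W σ t 2 [ZMOD n 1]) ↔
      s ≡ t [ZMOD (Λ * K : ℕ)]) : HasRun n 2 := by
  refine HasRun.of_block hΛ hK hadj hwrap hσ fun s t => ?_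
  rw [Fin.prod_univ_three, hcard, Nat.cast_mul (Λ * K) (n 2),
    ← modEq_mul_iff (x := fun t => blockPos Λ K W σ t 2) hmerge
      (u := 1) (a := K * wordSum (W false) σ Λ 2 + 1) (fun t => ?_)
      (by exact_mod_cast (Nat.mul_pos hΛ hK).ne') one_ne_zero hcop, one_mul]
  · simp only [Fin.forall_fin_succ, IsEmpty.forall_iff, and_true]
    have hd : (n 1 : ℤ) ∣ n 2 := by exact_mod_cast hdvd
    constructor
    · rintro ⟨h0, h1, h2⟩
      exact ⟨⟨h0, h1.add (h2.of_dvd hd)⟩, h2⟩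
    · rintro ⟨⟨h0, h1⟩, h2⟩
      exact ⟨h0, (h2.of_dvd hd).add_right_cancel h1, h2⟩
  · rw [blockPos_add_mul hΛ hK, hspecial]
    ring

end Block

/-- The word of length `L` in the dimensions `0, 1, 2` which uses `0` exactly at the positions `ρ`
and `L - 1` and alternates between `1` and `2` elsewhere; the kind `e` tells which of `1` and `2`
comes first in the initial stretch of length `ρ`. -/
def alternatingWord (L ρ : ℕ) (e : Bool) (j : ℕ) : Fin 3 :=
  if j = ρ ∨ j = L - 1 then 0
  else if j < ρ then (if (j + e.toNat) % 2 = 0 then 1 else 2)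
  else (if j % 2 = 0 then 1 else 2)

theorem alternatingWord_eq_zero_iff {L ρ : ℕ} {e : Bool} {j : ℕ} :
    alternatingWord L ρ e j = 0 ↔ j = ρ ∨ j = L - 1 := by
  unfold alternatingWord
  split_ifs <;> simp_all

theorem wordSum_alternatingWord_zero {L ρ : ℕ} (hρ : ρ < L) (e : Bool) :
    wordSum (alternatingWord L ρ e) 1 L 0 = if ρ = L - 1 then 1 else 2 := by
  have h : wordSum (alternatingWord L ρ e) 1 L 0 = ((({ρ, L - 1} : Finset ℕ).card : ℕ) : ℤ) := by
    simp only [wordSum, alternatingWord_eq_zero_iff, Pi.one_apply, Finset.sum_boole]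
    congr 2
    ext j
    simp only [Finset.mem_filter, Finset.mem_range, Finset.mem_insert, Finset.mem_singleton]
    omega
  rw [h]
  split_ifs with h
  · simp [h]
  · rw [Finset.card_pair h]; rfl

theorem wordSum_alternatingWord_two {L ρ : ℕ} (hρ : ρ < L) (hodd : Odd ρ) :
    wordSum (alternatingWord L ρ true) 1 L 2 =
      wordSum (alternatingWord L ρ false) 1 L 2 + 1 := by
  have key : ∀ j ≤ L, wordSum (alternatingWord L ρ true) 1 j 2 =
      wordSum (alternatingWord L ρ false) 1 j 2 + ((min j ρ % 2 : ℕ) : ℤ) := by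
    intro j hj
    induction j with
    | zero => simp [wordSum]
    | succ j ih =>
      have ih := ih (by omega)
      simp only [wordSum] at ih ⊢
      rw [Finset.sum_range_succ, Finset.sum_range_succ, ih]
      simp only [alternatingWord, Pi.one_apply, Bool.toNat_true, Bool.toNat_false]
      split_ifs <;> simp_all <;> omega
  rw [key L le_rfl, min_eq_right hρ.le, Nat.odd_iff.1 hodd, Nat.cast_one]

theorem HasRun.of_alternatingWord {n : Fin 3 → ℕ} {ρ : ℕ} (h0 : 0 < n 0) (h1 : 0 < n 1)
    (h01 : n 0 ∣ n 1) (h12 : n 1 ∣ n 2) (hρ : ρ < n 0) (hodd : Odd ρ) (hρ' : ρ ≠ n 0 - 2)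
    (hcop : IsCoprime ((n 0 : ℤ) - if ρ = n 0 - 1 then 1 else 2) (n 1 : ℤ))
    (hrad : ∀ b : ℤ, IsCoprime (n 1 * b + 1) (n 2 : ℤ)) : HasRun n 2 := by
  have hL : (n 0 : ℤ) ≠ 0 := by exact_mod_cast h0.ne'
  have hρ0 := hodd.pos
  set W := alternatingWord (n 0) ρ with hW
  refine HasRun.of_block_of_merge (W := W) (σ := 1) h0 h1 (fun e j hj => ?_)
    (fun e e' => ?_) (fun j => Or.inl rfl) h12 rfl (wordSum_alternatingWord_two hρ hodd)
    (hrad _) fun s t => ?_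
  · obtain ⟨k, rfl⟩ := hodd
    simp only [hW, alternatingWord]
    split_ifs <;> first | decide | omega
  · rw [hW, alternatingWord_eq_zero_iff.2 (Or.inr rfl), ne_comm, Ne,
      alternatingWord_eq_zero_iff]
    omega
  · have hZ : ∀ t, blockPos (n 0) (n 1) W 1 t 0 = t / n 0 * wordSum (W false) 1 (n 0) 0 +
        wordSum (W false) 1 (t % n 0).toNat 0 := blockPos_of_forall_iff h0 fun e j _ => by
      rw [hW, alternatingWord_eq_zero_iff, alternatingWord_eq_zero_iff]
    have htot : ∀ t, blockPos (n 0) (n 1) W 1 t 1 + blockPos (n 0) (n 1) W 1 t 2 =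
        t - blockPos (n 0) (n 1) W 1 t 0 := fun t => by
      have h := sum_blockPos (Λ := n 0) (K := n 1) (W := W) (σ := 1) t
      simp only [Fin.sum_univ_three, Pi.one_apply, Finset.sum_const, Finset.card_range, nsmul_eq_mul,
        mul_one, Int.toNat_of_nonneg (Int.emod_nonneg t hL), mul_comm (t / (n 0 : ℤ)),
        Int.mul_ediv_add_emod] at h
      linarith
    have hd : (n 0 : ℤ) ∣ n 1 := by exact_mod_cast h01
    rw [Nat.cast_mul, ← modEq_mul_iff (E := fun s t => s ≡ t [ZMOD n 0])
      (x := fun t => t - blockPos (n 0) (n 1) W 1 t 0) (fun _ _ => Iff.rfl) (u := 1)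
      (a := n 0 - wordSum (W false) 1 (n 0) 0) (fun t => ?_) hL one_ne_zero ?_, one_mul, htot, htot]
    · constructor
      · rintro ⟨h1, h2⟩
        exact ⟨by simpa using h1.add (h2.of_dvd hd), h2⟩
      · rintro ⟨h1, h2⟩
        exact ⟨by simpa using h1.sub (h2.of_dvd hd), h2⟩
    · rwa [hW, wordSum_alternatingWord_zero hρ]
    · rw [hZ, hZ, Int.add_ediv_of_dvd_right (dvd_refl _), Int.ediv_self hL, Int.add_emod_right]
      ring

/-- A closed walk of length `27` around the torus with sizes `3, 9`, whose steps in the second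
dimension are distributed over the dimensions `1` and `2`. The kind `e` affects the first five
steps. -/
def threeNineWord (e : Bool) (j : ℕ) : Fin 3 :=
  if j < 5 then (if (j + e.toNat) % 2 = 0 then 1 else 2)
  else [1, 2, 1, 2, 1, 0, 1, 2, 0, 1, 2, 1, 0, 1, 0, 1, 0, 1, 0, 1, 2, 0, 1, 2, 0, 1, 0].getD j 0

/-- The signs of the steps of `threeNineWord`. -/
def threeNineSign (j : ℕ) : ℤ :=
  if j ∈ [12, 16, 26] then -1 else 1

/-- A Hamiltonian cycle of the torus with sizes `3, 3, 3`. -/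
def threeWord (j : ℕ) : Fin 3 :=
  [2, 1, 2, 1, 0, 2, 1, 2, 0, 2, 0, 1, 0, 2, 0, 1, 0, 1, 2, 0, 1, 0, 1, 2, 1, 2, 0].getD j 0

/-- The signs of the steps of `threeWord`. -/
def threeSign (j : ℕ) : ℤ :=
  if j ∈ [3, 10, 12, 13, 14, 16, 17, 18, 19, 20, 21, 23] then -1 else 1

theorem modEq_iff_of_injOn {α : Type*} {f : ℤ → α} {g : ℕ → α} {Λ : ℕ} (hΛ : 0 < Λ)
    (hf : ∀ t, f t = g (t % Λ).toNat) (hg : ((List.range Λ).map g).Nodup) (s t : ℤ) :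
    f s = f t ↔ s ≡ t [ZMOD Λ] := by
  have hΛ' : (0 : ℤ) < Λ := by exact_mod_cast hΛ
  have h1 := Int.emod_lt_of_pos s hΛ'
  have h2 := Int.emod_nonneg s hΛ'.ne'
  have h3 := Int.emod_lt_of_pos t hΛ'
  have h4 := Int.emod_nonneg t hΛ'.ne'
  rw [hf, hf, Int.ModEq]
  refine ⟨fun h => ?_, fun h => by rw [h]⟩
  have := List.inj_on_of_nodup_map hg (List.mem_range.2 (by omega)) (List.mem_range.2 (by omega)) h
  omega

theorem HasRun.of_three_nine {n : Fin 3 → ℕ} {i : ℕ} (h0 : n 0 = 3) (h1 : n 1 = 9 * 3 ^ i)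
    (h12 : n 1 ∣ n 2) (hrad : ∀ b : ℤ, IsCoprime (3 * b + 1) (n 2 : ℤ)) : HasRun n 2 := by
  have hK : 0 < 3 ^ i := by positivity
  have htwo : wordSum (threeNineWord false) threeNineSign 27 2 = 6 := by decide +kernel
  refine HasRun.of_block_of_merge (Λ := 27) (K := 3 ^ i) (W := threeNineWord) (σ := threeNineSign)
    (by norm_num) hK (fun e j hj => ?_) (fun e e' => ?_) (fun j => ?_) h12 (by rw [h0, h1]; ring)
    (by decide +kernel) (by rw [htwo]; convert hrad (3 ^ i * 2) using 1; push_cast; ring)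
    fun s t => ?_
  · have : ∀ e, ∀ j < 26, threeNineWord e j ≠ threeNineWord e (j + 1) := by decide +kernel
    exact this e j (by omega)
  · revert e e'; decide +kernel
  · unfold threeNineSign; split_ifs <;> simp
  · set B := blockPos 27 (3 ^ i) threeNineWord threeNineSign
    set w := wordSum (threeNineWord false) threeNineSign
    have hZ : ∀ t, B t 0 = t / 27 * 3 + w (t % 27).toNat 0 := fun t => by
      rw [show (3 : ℤ) = w 27 0 by decide +kernel]
      exact blockPos_of_forall_iff (by norm_num) (by decide +kernel) t
    have htot : ∀ t, B t 1 + B t 2 = t / 27 * 18 + (w (t % 27).toNat 1 + w (t % 27).toNat 2) :=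
      fun t => by
        have h := sum_blockPos (Λ := 27) (K := 3 ^ i) (W := threeNineWord) (σ := threeNineSign) t
        rw [← sum_wordSum (threeNineWord false), ← sum_wordSum (threeNineWord false),
          Fin.sum_univ_three, Fin.sum_univ_three, Fin.sum_univ_three] at h
        have h0 := hZ t
        have h18 : w 27 0 + w 27 1 + w 27 2 = 21 := by decide +kernel
        simp only [w, B, Nat.cast_ofNat] at h h0 h18 ⊢
        rw [h18] at h
        linarith
    rw [h0, h1, Nat.cast_mul, Nat.cast_mul, ← modEq_mul_iff
      (E := fun s t => B s 0 ≡ B t 0 [ZMOD 3] ∧ B s 1 + B s 2 ≡ B t 1 + B t 2 [ZMOD 9])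
      (x := fun t => B t 1 + B t 2) (P := (27 : ℕ)) (u := (9 : ℕ)) (a := 2) (fun s t => ?_)
      (fun t => ?_) (by norm_num) (by norm_num) ?_]
    · exact ⟨fun h => ⟨⟨h.1, h.2.of_mul_right _⟩, h.2⟩, fun h => ⟨h.1.1, h.2⟩⟩
    · push_cast
      exact IsCoprime.pow_right ⟨-1, 1, by norm_num⟩
    · rw [← modEq_iff_of_injOn (f := fun t => (B t 0 % 3, (B t 1 + B t 2) % 9))
        (g := fun j => (w j 0 % 3, (w j 1 + w j 2) % 9)) (by norm_num) (fun t => ?_)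
        (by decide +kernel), Prod.mk.injEq]
      · rfl
      · simp only [hZ, htot, Nat.cast_ofNat, Prod.mk.injEq]
        omega
    · simp only [htot, Nat.cast_ofNat]
      rw [Int.add_emod_right]
      omega

theorem HasRun.of_three_three {n : Fin 3 → ℕ} {i : ℕ} (h0 : n 0 = 3) (h1 : n 1 = 3)
    (h2 : n 2 = 3 * 3 ^ i) : HasRun n 2 := by
  refine HasRun.of_block (Λ := 27) (K := 1) (W := fun _ => threeWord) (σ := threeSign)
    (by norm_num) one_pos (fun e j hj => ?_) (by decide +kernel) (fun j => ?_) fun s t => ?_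
  · have : ∀ j < 26, threeWord j ≠ threeWord (j + 1) := by decide +kernel
    exact this j (by omega)
  · unfold threeSign; split_ifs <;> simp
  · set B := blockPos 27 1 (fun _ => threeWord) threeSign
    set w := wordSum threeWord threeSign
    have hB : ∀ t i, B t i = t / 27 * w 27 i + w (t % 27).toNat i := fun t i =>
      blockPos_of_forall_iff (by norm_num) (fun _ _ _ => Iff.rfl) t
    have hw : w 27 0 = -3 ∧ w 27 1 = 3 ∧ w 27 2 = 3 := by decide +kernel
    rw [show ((∏ i, n i : ℕ) : ℤ) = (27 : ℕ) * 3 ^ i by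
      rw [Fin.prod_univ_three, h0, h1, h2]; push_cast; ring, ← modEq_mul_iff
      (E := fun s t => (B s 0 ≡ B t 0 [ZMOD 3] ∧ B s 1 ≡ B t 1 [ZMOD 3]) ∧ B s 2 ≡ B t 2 [ZMOD 3])
      (x := fun t => B t 2) (u := 3) (a := 1) (fun s t => ?_)
      (fun t => ?_) (by norm_num) (by norm_num) isCoprime_one_left]
    · simp only [Fin.forall_fin_succ, IsEmpty.forall_iff, and_true]
      simp only [Fin.succ_zero_eq_one, Fin.succ_one_eq_two, h0, h1, h2]
      push_cast
      exact ⟨fun h => ⟨⟨⟨h.1, h.2.1⟩, h.2.2.of_mul_right _⟩, h.2.2⟩,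
        fun h => ⟨h.1.1.1, h.1.1.2, h.2⟩⟩
    · rw [← modEq_iff_of_injOn (f := fun t => ((B t 0 % 3, B t 1 % 3), B t 2 % 3))
        (g := fun j => ((w j 0 % 3, w j 1 % 3), w j 2 % 3)) (by norm_num) (fun t => ?_)
        (by decide +kernel), Prod.mk.injEq, Prod.mk.injEq]
      · rfl
      · simp only [hB, hw, Prod.mk.injEq, Nat.cast_ofNat]
        omega
    · simp only [hB, hw, Nat.cast_ofNat]
      rw [Int.add_emod_right]
      omega

theorem HasRun.of_prime_pow_three {p : ℕ} (hp : p.Prime) {n : Fin 3 → ℕ} (h3 : ∀ i, 3 ≤ n i)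
    (hpow : ∀ i, ∃ e, n i = p ^ e) : HasRun n 2 := by
  choose e he using hpow
  refine HasRun.comp_equiv (Tuple.sort e) ?_
  have hmono : Monotone (e ∘ Tuple.sort e) := Tuple.monotone_sort e
  generalize Tuple.sort e = τ at hmono ⊢
  have h3' : ∀ i, 3 ≤ (n ∘ τ) i := fun i => h3 _
  have he' : ∀ i, (n ∘ τ) i = p ^ (e ∘ τ) i := fun i => he _
  generalize n ∘ τ = m at h3' he' ⊢
  generalize e ∘ τ = f at hmono he'
  have hf : ∀ i, 0 < f i := fun i => by
    by_contra h
    have := h3' i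
    rw [he' i, Nat.eq_zero_of_not_pos h] at this
    norm_num at this
  have hpm : ∀ i, ∃ k : ℤ, (m i : ℤ) = p * k := fun i => by
    rw [he' i]
    push_cast
    exact dvd_pow_self (p : ℤ) (hf i).ne'
  have hdvd : ∀ {i j}, i ≤ j → m i ∣ m j := fun {i j} h => by
    rw [he' i, he' j]; exact pow_dvd_pow p (hmono h)
  have hcop : ∀ (x : ℤ) i, IsCoprime x p → IsCoprime x (m i : ℤ) := fun x i h => by
    rw [he' i]; push_cast; exact h.pow_right
  have hrad : ∀ i (k b : ℤ), IsCoprime (p * k * b + 1) (m i : ℤ) := fun i k b =>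
    hcop _ i ⟨1, -(k * b), by ring⟩
  rcases (h3' 0).lt_or_eq with h4 | h4
  · obtain ⟨k, hk⟩ := hpm 0
    obtain ⟨k', hk'⟩ := hpm 1
    rcases Nat.even_or_odd (m 0) with heven | hodd
    · refine HasRun.of_alternatingWord (ρ := m 0 - 1) (by omega) (by linarith [h3' 1])
        (hdvd (by decide)) (hdvd (by decide)) (by omega) (Nat.Even.sub_odd (by omega) heven odd_one)
        (by omega) ?_ (by rw [hk']; exact hrad 2 k')
      rw [if_pos rfl, hk]
      exact hcop _ 1 ⟨-1, k, by ring⟩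
    · refine HasRun.of_alternatingWord (ρ := 1) (by omega) (by linarith [h3' 1])
        (hdvd (by decide)) (hdvd (by decide)) (by omega) odd_one
        (by omega) ?_ (by rw [hk']; exact hrad 2 k')
      rw [if_neg (by omega)]
      refine hcop _ 1 ?_
      obtain ⟨j, hj⟩ : Odd p := by
        rw [he' 0] at hodd
        exact Nat.Odd.of_mul_left (n := p ^ (f 0 - 1))
          (by rwa [← pow_succ', Nat.sub_add_cancel (hf 0)])
      have hj' : (p : ℤ) = 2 * j + 1 := by exact_mod_cast hj
      rw [hk]
      exact ⟨j, 1 - j * k, by rw [hj']; ring⟩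
  · obtain rfl : p = 3 := by
      have h : p ∣ 3 := by rw [h4, he' 0]; exact dvd_pow_self p (hf 0).ne'
      exact (Nat.prime_dvd_prime_iff_eq hp Nat.prime_three).1 h
    obtain ⟨i, hi⟩ := Nat.exists_eq_succ_of_ne_zero (hf 1).ne'
    rcases i with _ | i
    · refine HasRun.of_three_three (i := f 2 - 1) h4.symm (by rw [he' 1, hi]; rfl) ?_
      rw [he' 2, ← pow_succ', Nat.sub_add_cancel (hf 2)]
    · exact HasRun.of_three_nine (i := i) h4.symm (by rw [he' 1, hi, pow_succ, pow_succ]; ring) (hdvd (by decide))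
        (by simpa using hrad 2 1)

theorem HasRun.one_of_unique {ι : Type*} [Fintype ι] [Unique ι] (n : ι → ℕ) : HasRun n 1 :=
  ⟨fun t _ => t, fun _ => default, fun _ => ⟨Or.inl rfl, fun i hi => (hi (Subsingleton.elim _ _)).elim⟩,
    fun s t => by simp [Unique.forall_iff], fun s t h1 h2 => by omega⟩

/-- Interleaving Hamiltonian cycles of two tori whose numbers of vertices are powers of `p`, taking
`a` out of every `p ^ m` steps in the first one. -/
theorem HasRun.sum_of_le {ι κ : Type*} [Fintype ι] [Fintype κ] {n : ι ⊕ κ → ℕ} {p M m r s R : ℕ}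
    {a : ℤ} (hp : 0 < p) (hι : ∏ i, n (Sum.inl i) = p ^ M) (hκ : ∏ i, n (Sum.inr i) = p ^ m)
    (hmM : m ≤ M) (hG : HasRun (n ∘ Sum.inl) r) (hH : HasRun (n ∘ Sum.inr) s)
    (hcop : IsCoprime a p) (ha0 : 0 ≤ a) (haL : a ≤ p ^ m) (hr : a * R ≤ p ^ m * r)
    (hs : (p : ℤ) ^ m * R ≤ a * R + p ^ m * s) : HasRun n R := by
  obtain ⟨c₁, d₁, hstep₁, hinj₁, hrun₁⟩ := hG
  obtain ⟨c₂, d₂, hstep₂, hinj₂, hrun₂⟩ := hH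
  simp only [Function.comp_apply] at hinj₁ hinj₂
  rw [hι] at hinj₁
  rw [hκ] at hinj₂
  have hL : (0 : ℤ) < p ^ m := by positivity
  set g : ℤ → ℤ := fun t => a * t / p ^ m with hg
  have hmono : Monotone g := fun s t h => Int.ediv_le_ediv hL (mul_le_mul_of_nonneg_left h ha0)
  have hadd : ∀ t u v : ℤ, a * u ≤ p ^ m * v → g (t + u) ≤ g t + v := fun t u v h => by
    simp only [hg]
    rw [← Int.add_mul_ediv_left _ _ hL.ne']
    exact Int.ediv_le_ediv hL (by linarith)
  have hadd' : ∀ t u v : ℤ, p ^ m * v ≤ a * u → g t + v ≤ g (t + u) := fun t u v h => by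
    simp only [hg]
    rw [← Int.add_mul_ediv_left _ _ hL.ne']
    exact Int.ediv_le_ediv hL (by linarith)
  have hsucc : ∀ t, g (t + 1) = g t + 1 ∨ g (t + 1) = g t := fun t => by
    have h1 := hmono (show t ≤ t + 1 by omega)
    have h2 := hadd t 1 1 (by linarith)
    omega
  refine ⟨fun t => Sum.elim (c₁ (g t)) (c₂ (t - g t)),
    fun t => if g (t + 1) = g t + 1 then Sum.inl (d₁ (g t)) else Sum.inr (d₂ (t - g t)),
    fun t => ?_, fun s t => ?_, fun t u htu hut => ?_⟩
  · dsimp only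
    rcases hsucc t with h | h
    · rw [if_pos h, h, add_sub_add_right_eq_sub]
      refine ⟨(hstep₁ (g t)).1, ?_⟩
      rintro (i | i) hi
      · exact (hstep₁ (g t)).2 i fun h => hi (by rw [h])
      · rfl
    · rw [if_neg (by omega), h, add_sub_right_comm]
      refine ⟨(hstep₂ (t - g t)).1, ?_⟩
      rintro (i | i) hi
      · rfl
      · exact (hstep₂ (t - g t)).2 i fun h => hi (by rw [h])
  · rw [Sum.forall, Fintype.prod_sum_type, hι, hκ, mul_comm, Nat.cast_mul]
    simp only [Sum.elim_inl, Sum.elim_inr]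
    rw [hinj₁, hinj₂, ← modEq_mul_iff (E := fun s t => s ≡ t [ZMOD (p ^ m : ℕ)]) (x := g)
      (fun _ _ => Iff.rfl) (u := 1) (a := a) (fun t => ?_) (by exact_mod_cast hL.ne') one_ne_zero
      (by push_cast; exact hcop.pow_right), one_mul]
    · have hd : ((p ^ m : ℕ) : ℤ) ∣ (p ^ M : ℕ) := by exact_mod_cast pow_dvd_pow p hmM
      constructor
      · rintro ⟨h1, h2⟩
        exact ⟨by simpa using (h1.of_dvd hd).add h2, h1⟩
      · rintro ⟨h1, h2⟩
        exact ⟨h2, h1.sub (h2.of_dvd hd)⟩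
    · simp only [hg]
      rw [Nat.cast_pow, mul_add, mul_comm a (p ^ m : ℤ), Int.add_mul_ediv_left _ _ hL.ne', one_mul]
  · have hut' := hmono (show u + 1 ≤ t + R by omega)
    have htu' := hmono (show t + 1 ≤ u by omega)
    have h1 := hadd t R r hr
    have h2 := hadd' t R (R - s) (by linarith)
    have h3 := hadd (u + 1) (t + R - (u + 1)) _ (mul_le_mul_of_nonneg_right haL (by omega))
    have h4 := hadd (t + 1) (u - (t + 1)) _ (mul_le_mul_of_nonneg_right haL (by omega))
    rw [add_sub_cancel] at h3 h4
    dsimp only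
    rcases hsucc t with ht | ht <;> rcases hsucc u with hu | hu
    · rw [if_pos ht, if_pos hu]
      exact fun h => hrun₁ (g t) (g u) (by omega) (by omega) (Sum.inl_injective h)
    · rw [if_pos ht, if_neg (by omega)]
      exact Sum.inl_ne_inr
    · rw [if_neg (by omega), if_pos hu]
      exact Sum.inr_ne_inl
    · rw [if_neg (by omega), if_neg (by omega)]
      exact fun h => hrun₂ (t - g t) (u - g u) (by omega) (by omega) (Sum.inr_injective h)

theorem HasRun.sum {ι κ : Type*} [Fintype ι] [Fintype κ] {n : ι ⊕ κ → ℕ} {p M m r s R : ℕ}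
    {a : ℤ} (hp : 0 < p) (hι : ∏ i, n (Sum.inl i) = p ^ M) (hκ : ∏ i, n (Sum.inr i) = p ^ m)
    (hG : HasRun (n ∘ Sum.inl) r) (hH : HasRun (n ∘ Sum.inr) s)
    (hpos : min M m ≠ 0) (hcop : IsCoprime a p) (ha0 : 0 ≤ a) (haL : a ≤ p ^ min M m)
    (hr : a * R ≤ p ^ min M m * r) (hs : (p : ℤ) ^ min M m * R ≤ a * R + p ^ min M m * s) :
    HasRun n R := by
  rcases le_total m M with h | h
  · rw [min_eq_right h] at *
    exact hG.sum_of_le hp hι hκ h hH hcop ha0 haL hr hs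
  · rw [min_eq_left h] at *
    refine HasRun.comp_equiv (Equiv.sumComm κ ι) ?_
    refine HasRun.sum_of_le (n := n ∘ Equiv.sumComm κ ι) (a := p ^ M - a) hp hκ hι h hH hG ?_
      (by linarith) (by linarith) (by linarith) (by linarith)
    obtain ⟨k, hk⟩ := dvd_pow_self (p : ℤ) hpos
    rw [hk, sub_eq_neg_add]
    exact hcop.neg_left.add_mul_left_left k

theorem exists_isCoprime_div {p r s R : ℕ} {L : ℤ} (hp : p.Prime) (hr : 0 < r) (hs : 0 < s)
    (hR : R + 1 = r + s) (hL : 2 * (R : ℤ) ≤ L) :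
    ∃ a : ℤ, IsCoprime a p ∧ 0 ≤ a ∧ a ≤ L ∧ a * R ≤ L * r ∧ L * R ≤ a * R + L * s := by
  have hR0 : (0 : ℤ) < R := by omega
  have hp' := Nat.prime_iff_prime_int.1 hp
  set q := L * r / R
  have hq1 : q * R ≤ L * r := Int.ediv_mul_le _ hR0.ne'
  have hq2 : L * r < (q + 1) * R := Int.lt_ediv_add_one_mul_self _ hR0
  have hrR : (r : ℤ) ≤ R := by omega
  have hsR : (R : ℤ) + 1 = r + s := by omega
  have h0 : 0 < q := by
    have : (2 * (R : ℤ)) * 1 ≤ L * r := mul_le_mul hL (by omega) (by omega) (by omega)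
    by_contra h
    nlinarith
  have hqL : q ≤ L := by
    by_contra h
    nlinarith
  have key : ∃ a : ℤ, ¬ (p : ℤ) ∣ a ∧ q - 1 ≤ a ∧ a ≤ q := by
    by_cases h : (p : ℤ) ∣ q
    · refine ⟨q - 1, fun h' => hp'.not_isUnit (isUnit_of_dvd_one ?_), le_rfl, by omega⟩
      simpa using dvd_sub h h'
    · exact ⟨q, h, by omega, le_rfl⟩
  obtain ⟨a, ha, h1, h2⟩ := key
  refine ⟨a, (hp'.coprime_iff_not_dvd.2 ha).symm, by omega, by omega, by nlinarith, ?_⟩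
  have h3 : (q - 1) * R ≤ a * R := mul_le_mul_of_nonneg_right h1 hR0.le
  have h4 : L * (R + 1) = L * (r + s) := by rw [hsR]
  linarith

theorem exists_prod_eq_pow {ι : Type*} [Fintype ι] {n : ι → ℕ} {p : ℕ} (h3 : ∀ i, 3 ≤ n i)
    (hpow : ∀ i, ∃ e, n i = p ^ e) : ∃ M, ∏ i, n i = p ^ M ∧ 3 ^ Fintype.card ι ≤ p ^ M := by
  choose e he using hpow
  have h : ∏ i, n i = p ^ ∑ i, e i := by
    rw [← Finset.prod_pow_eq_pow_sum]
    exact Finset.prod_congr rfl fun i _ => he i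
  exact ⟨_, h, h ▸ Finset.pow_card_le_prod _ _ _ fun i _ => h3 i⟩

theorem HasRun.append {a b : ℕ} {n : Fin (a + b) → ℕ} {p r s R : ℕ} (hp : p.Prime)
    (h3 : ∀ i, 3 ≤ n i) (hpow : ∀ i, ∃ e, n i = p ^ e)
    (hG : HasRun (fun i => n (Fin.castAdd b i)) r) (hH : HasRun (fun i => n (Fin.natAdd a i)) s)
    (ha : 0 < a) (hb : 0 < b)
    (hx : ∀ L : ℕ, p ∣ L → 3 ^ min a b ≤ L → ∃ x : ℤ, IsCoprime x p ∧ 0 ≤ x ∧ x ≤ L ∧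
      x * R ≤ L * r ∧ (L : ℤ) * R ≤ x * R + L * s) : HasRun n R := by
  obtain ⟨M, hM, hM'⟩ := exists_prod_eq_pow (n := fun i => n (Fin.castAdd b i))
    (fun _ => h3 _) fun _ => hpow _
  obtain ⟨m, hm, hm'⟩ := exists_prod_eq_pow (n := fun i => n (Fin.natAdd a i))
    (fun _ => h3 _) fun _ => hpow _
  rw [Fintype.card_fin] at hM' hm'
  have hlarge : 3 ^ min a b ≤ p ^ min M m := by
    rcases le_total m M with h | h
    · rw [min_eq_right h]
      exact (Nat.pow_le_pow_right (by norm_num) (min_le_right _ _)).trans hm'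
    · rw [min_eq_left h]
      exact (Nat.pow_le_pow_right (by norm_num) (min_le_left _ _)).trans hM'
  have hpos : min M m ≠ 0 := fun h => by
    rw [h, pow_zero] at hlarge
    exact absurd hlarge (Nat.one_lt_pow (by omega) (by norm_num)).not_ge
  obtain ⟨x, h1, h2, h3, h4, h5⟩ := hx _ (dvd_pow_self p hpos) hlarge
  push_cast at h3 h4 h5
  exact HasRun.comp_equiv finSumFinEquiv
    (HasRun.sum (n := n ∘ finSumFinEquiv) hp.pos hM hm hG hH hpos h1 h2 h3 h4 h5)

theorem HasRun.of_prime_pow {p : ℕ} (hp : p.Prime) {k : ℕ} (hk : 3 ≤ k) {n : Fin k → ℕ}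
    (h3 : ∀ i, 3 ≤ n i) (hpow : ∀ i, ∃ e, n i = p ^ e) : HasRun n (k / 3 + 1) := by
  induction k using Nat.strong_induction_on with
  | _ k ih =>
    rcases lt_or_ge k 6 with h6 | h6
    · rcases hk.eq_or_lt with rfl | h4
      · exact HasRun.of_prime_pow_three hp h3 hpow
      · obtain ⟨j, rfl⟩ : ∃ j, k = j + 1 := ⟨k - 1, by omega⟩
        have h1 := ih j (by omega) (by omega) (fun i => h3 (Fin.castAdd 1 i)) fun i => hpow _
        rw [show j / 3 + 1 = 2 by omega] at h1
        rw [show (j + 1) / 3 + 1 = 2 by omega]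
        refine HasRun.append hp h3 hpow h1 (HasRun.one_of_unique _) (by omega) one_pos
          fun L hL hL3 => ?_
        rw [show min j 1 = 1 by omega, pow_one] at hL3
        refine ⟨L - 1, ?_, by omega, by omega, by push_cast; omega, by push_cast; omega⟩
        obtain ⟨c, rfl⟩ := hL
        exact ⟨-1, c, by push_cast; ring⟩
    · obtain ⟨j, hj⟩ : ∃ j, j = 3 * (k / 6) := ⟨_, rfl⟩
      obtain ⟨i, rfl⟩ : ∃ i, k = i + j := ⟨k - j, by omega⟩
      refine HasRun.append hp h3 hpow (ih i (by omega) (by omega) (fun _ => h3 _) fun _ => hpow _)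
        (ih j (by omega) (by omega) (fun _ => h3 _) fun _ => hpow _) (by omega) (by omega)
        fun L _ hL => exists_isCoprime_div hp (by omega) (by omega) (by omega) ?_
      have hq : ∀ q, 1 ≤ q → 4 * q + 4 ≤ 27 ^ q := fun q hq => by
        induction q, hq using Nat.le_induction with
        | base => norm_num
        | succ q _ ih => rw [pow_succ]; omega
      have h1 := hq ((i + j) / 6) (by omega)
      rw [show (27 : ℕ) = 3 ^ 3 by norm_num, ← pow_mul, ← hj] at h1
      rw [show min i j = j by omega] at hL
      omega

theorem exists_edgeInDim {k : ℕ} {sz : Fin k → ℕ} (hsz : ∀ i, 3 ≤ sz i)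
    {f : ZMod (torusCard k sz) → TorusVtx k sz} (hf : IsHamCycle f) (s : ZMod (torusCard k sz)) :
    ∃ i, EdgeInDim f i s := by
  obtain ⟨i, hi, -⟩ := hf.2 s
  have : Fact (1 < sz i) := ⟨by linarith [hsz i]⟩
  refine ⟨i, fun h => ?_⟩
  rcases hi with hi | hi <;> simp [← h] at hi

theorem WindowOk.le_torusCard {k : ℕ} {sz : Fin k → ℕ} (hsz : ∀ i, 3 ≤ sz i)
    {f : ZMod (torusCard k sz) → TorusVtx k sz} (hf : IsHamCycle f) {r : ℕ} (h : WindowOk f r) :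
    r ≤ torusCard k sz := by
  by_contra! hr
  have hpos : 0 < torusCard k sz := Finset.prod_pos fun i _ => by linarith [hsz i]
  obtain ⟨i, hi⟩ := exists_edgeInDim hsz hf 0
  exact h 0 i 0 _ (by omega) hr hpos.ne (by simpa using hi)

theorem HasRun.exists_isHamCycle {k : ℕ} {sz : Fin k → ℕ} (hsz : ∀ i, 3 ≤ sz i) {R : ℕ}
    (h : HasRun sz R) :
    ∃ f : ZMod (torusCard k sz) → TorusVtx k sz, IsHamCycle f ∧ WindowOk f R := by
  obtain ⟨c, d, hstep, hinj, hrun⟩ := h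
  have hpos : 0 < torusCard k sz := Finset.prod_pos fun i _ => by linarith [hsz i]
  have : NeZero (torusCard k sz) := ⟨hpos.ne'⟩
  have (i : Fin k) : NeZero (sz i) := ⟨by linarith [hsz i]⟩
  let v : ℤ → TorusVtx k sz := fun t i => (c t i : ZMod (sz i))
  have hv : ∀ s t, v s = v t ↔ s ≡ t [ZMOD torusCard k sz] := fun s t => by
    rw [torusCard, ← hinj]
    exact ⟨fun h i => (ZMod.intCast_eq_intCast_iff _ _ _).1 (congrFun h i),
      fun h => funext fun i => (ZMod.intCast_eq_intCast_iff _ _ _).2 (h i)⟩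
  have hadj : ∀ t, TorusAdj (v t) (v (t + 1)) := fun t => by
    refine ⟨d t, (hstep t).1.imp (fun h => ?_) fun h => ?_, fun j hj => ?_⟩
    · simp only [v, h]; push_cast; rfl
    · simp only [v, h]; push_cast; rfl
    · simp only [v, (hstep t).2 j hj]
  let f : ZMod (torusCard k sz) → TorusVtx k sz := fun t => v t.val
  have hf : ∀ t : ℤ, f t = v t := fun t => by
    rw [hv, ← ZMod.intCast_eq_intCast_iff]
    simp
  have hf' : ∀ t : ZMod (torusCard k sz), ∀ a : ℕ, f (t + a) = v (t.val + a) := fun t a => by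
    rw [← hf]
    simp
  refine ⟨f, ⟨?_, fun t => ?_⟩, ?_⟩
  · have hfi : Function.Injective f := fun s t h => by
      have := (hv _ _).1 h
      rw [← ZMod.intCast_eq_intCast_iff] at this
      simpa using this
    have : Finite (TorusVtx k sz) := inferInstanceAs (Finite (∀ i, ZMod (sz i)))
    refine hfi.bijective_of_nat_card_le ?_
    rw [Nat.card_zmod, show Nat.card (TorusVtx k sz) = Nat.card (∀ i, ZMod (sz i)) from rfl,
      Nat.card_pi]
    simp [torusCard]
  · have := hf' t 1
    rw [Nat.cast_one] at this
    rw [this]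
    exact hadj t.val
  · have hdim : ∀ (t : ZMod (torusCard k sz)) (i : Fin k) (a : ℕ),
        EdgeInDim f i (t + a) → i = d (t.val + a) := fun t i a h => by
      by_contra hne
      apply h
      have h1 := hf' t (a + 1)
      rw [Nat.cast_add_one, Nat.cast_add_one, ← add_assoc, ← add_assoc] at h1
      rw [h1, hf']
      simp only [v, (hstep _).2 i hne]
    rintro t i a b ha hb hab ⟨h1, h2⟩
    have h := (hdim t i a h1).symm.trans (hdim t i b h2)
    rcases hab.lt_or_gt with hlt | hlt
    · exact hrun _ _ (by omega) (by omega) h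
    · exact hrun _ _ (by omega) (by omega) h.symm

/-- **Application 5.**  Let `p` be a prime, `k ≥ 3`, and let
`G = γ₁ × ⋯ × γ_k` be a torus with `|G| = p^r` for some positive integer `r`.
Then `mrl(G) ≥ ⌊k/3⌋ + 1`. -/
theorem mrl_prime_power_general
    (p : ℕ) (hp : p.Prime) (k : ℕ) (hk : 3 ≤ k)
    (sz : Fin k → ℕ) (hsz : ∀ i, 3 ≤ sz i)
    (hcard : ∃ r : ℕ, 0 < r ∧ torusCard k sz = p ^ r) :
    k / 3 + 1 ≤ mrl k sz := by
  obtain ⟨r, -, hr⟩ := hcard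
  have hpow : ∀ i, ∃ e, sz i = p ^ e := fun i => by
    obtain ⟨e, -, he⟩ := (Nat.dvd_prime_pow hp).1
      (hr ▸ Finset.dvd_prod_of_mem sz (Finset.mem_univ i) : sz i ∣ p ^ r)
    exact ⟨e, he⟩
  obtain ⟨f, hf, hw⟩ := (HasRun.of_prime_pow hp hk hsz hpow).exists_isHamCycle hsz
  have hbdd : ∀ g : ZMod (torusCard k sz) → TorusVtx k sz, IsHamCycle g →
      ∀ r ∈ {r : ℕ | 1 ≤ r ∧ WindowOk g r}, r ≤ torusCard k sz :=
    fun g hg r hr => hr.2.le_torusCard hsz hg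
  calc k / 3 + 1 ≤ runLength f := le_csSup ⟨_, hbdd f hf⟩ ⟨by omega, hw⟩
    _ ≤ mrl k sz := by
      refine le_csSup ⟨torusCard k sz, ?_⟩ ⟨f, hf, rfl⟩
      rintro _ ⟨g, hg, rfl⟩
      exact csSup_le' (hbdd g hg)
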